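/- Let (L,d,[-,-],(-,-)) be a quasi-cyclic DG-Lie algebra of degree n over a field K of characteristic 0, with a splitting L = H ⊕ d(K) ⊕ K such that H^i = 0 for i < 0, H^0 is closed under the bracket, and H^i, K^i are H^0-submodules under the adjoint action for all i > 0. Then there exists a DG-Lie subalgebra L' ⊆ L such that: the inclusion L' → L is a quasi-isomorphism; the restriction of (-,-) makes L' a quasi-cyclic DG-Lie algebra of degree n; and L' admits a splitting L' = H ⊕ d(K') ⊕ K' satisfying (1) H^i = 0 for i < 0, (2) H^0 is closed under the bracket, (3) H^i and K'^i are H^0-submodules under the adjoint action for all i ∈ ℤ, and (4) H ⊥ K', i.e. (x,y) = 0 for all x ∈ H, y ∈ K'. -/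

import Mathlib

/-!
Core definitions: differential graded Lie algebras (DGLAs) over a field `K`,
their cohomology, morphisms, quasi-isomorphisms, zigzags and formality.

A ℤ-graded vector space is encoded as a module `carrier` together with an internal
direct sum decomposition `grading : ℤ → Submodule K carrier`.
-/

/-- A differential graded Lie algebra over `K`.  The differential `d` has degree `+1`,
the bracket `br` is graded skew-symmetric, satisfies the graded Jacobi identity and
`d` is a graded derivation with respect to it. -/
structure DGLA (K : Type) [Field K] : Type 1 where
  carrier : Type
  [acg : AddCommGroup carrier]
  [mod : Module K carrier]
  grading : ℤ → Submodule K carrier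
  internal : DirectSum.IsInternal grading
  d : carrier → carrier
  d_lin : IsLinearMap K d
  d_mem : ∀ i : ℤ, ∀ x ∈ grading i, d x ∈ grading (i + 1)
  d_sq : ∀ x, d (d x) = 0
  br : carrier → carrier → carrier
  br_lin₁ : ∀ y, IsLinearMap K fun x => br x y
  br_lin₂ : ∀ x, IsLinearMap K (br x)
  br_mem : ∀ i j : ℤ, ∀ x ∈ grading i, ∀ y ∈ grading j, br x y ∈ grading (i + j)
  skew : ∀ i j : ℤ, ∀ x ∈ grading i, ∀ y ∈ grading j,
      br x y = -((-1 : K) ^ (i * j) • br y x)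
  jacobi : ∀ i j : ℤ, ∀ x ∈ grading i, ∀ y ∈ grading j, ∀ z : carrier,
      br x (br y z) = br (br x y) z + (-1 : K) ^ (i * j) • br y (br x z)
  leibniz : ∀ i : ℤ, ∀ x ∈ grading i, ∀ y : carrier,
      d (br x y) = br (d x) y + (-1 : K) ^ i • br x (d y)

attribute [instance] DGLA.acg DGLA.mod

variable {K : Type} [Field K]

/-- The differential bundled as a linear map. -/
def DGLA.dHom (A : DGLA K) : A.carrier →ₗ[K] A.carrier := IsLinearMap.mk' A.d A.d_lin

/-- Degree `i` cocycles. -/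
def DGLA.cocycles (A : DGLA K) (i : ℤ) : Submodule K A.carrier :=
  A.grading i ⊓ LinearMap.ker A.dHom

/-- Degree `i` coboundaries. -/
def DGLA.coboundaries (A : DGLA K) (i : ℤ) : Submodule K A.carrier :=
  A.grading i ⊓ LinearMap.range A.dHom

/-- Degree `i` cohomology `H^i(L)` as a quotient vector space. -/
abbrev DGLA.cohomology (A : DGLA K) (i : ℤ) :=
  A.cocycles i ⧸ ((A.coboundaries i).comap (A.cocycles i).subtype)

/-- A morphism of DGLAs. -/
structure DGLAHom (A B : DGLA K) where
  toFun : A.carrier → B.carrier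
  lin : IsLinearMap K toFun
  map_grading : ∀ i : ℤ, ∀ x ∈ A.grading i, toFun x ∈ B.grading i
  map_d : ∀ x, toFun (A.d x) = B.d (toFun x)
  map_br : ∀ x y, toFun (A.br x y) = B.br (toFun x) (toFun y)

/-- `f` is a quasi-isomorphism: it induces bijections on cohomology in every degree. -/
def DGLAHom.IsQuasiIso {A B : DGLA K} (f : DGLAHom A B) : Prop :=
  ∀ i : ℤ,
    (∀ x ∈ A.cocycles i, f.toFun x ∈ B.coboundaries i → x ∈ A.coboundaries i) ∧
    (∀ y ∈ B.cocycles i, ∃ x ∈ A.cocycles i, f.toFun x - y ∈ B.coboundaries i)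

/-- There exists a quasi-isomorphism `A → B`. -/
def QIso (A B : DGLA K) : Prop := ∃ f : DGLAHom A B, f.IsQuasiIso

/-- Two DGLAs are connected by a zigzag of quasi-isomorphisms. -/
inductive ZigzagQIso : DGLA K → DGLA K → Prop
  | of {A B : DGLA K} : QIso A B → ZigzagQIso A B
  | refl (A : DGLA K) : ZigzagQIso A A
  | symm {A B : DGLA K} : ZigzagQIso A B → ZigzagQIso B A
  | trans {A B C : DGLA K} : ZigzagQIso A B → ZigzagQIso B C → ZigzagQIso A C

/-- A DGLA is formal if it is connected by a zigzag of quasi-isomorphisms to a DGLA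
with zero differential.  (This is equivalent to being connected by a zigzag of
quasi-isomorphisms to its cohomology `H^*(L)` endowed with the zero differential and
the induced bracket: any zero-differential DGLA quasi-isomorphic to `L` is isomorphic,
as a graded Lie algebra, to `H^*(L)` with the induced bracket.) -/
def DGLA.IsFormal (A : DGLA K) : Prop :=
  ∃ M : DGLA K, (∀ x, M.d x = 0) ∧ ZigzagQIso A M

/-- A quasi-cyclic DGLA of degree `n`: a DGLA with finite dimensional cohomology
equipped with a graded symmetric bilinear form of degree `-n`, compatible with `d`
and cyclic with respect to the bracket, whose induced pairing on cohomology is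
non-degenerate. -/
structure QCyclicDGLA (K : Type) [Field K] (n : ℤ) extends DGLA K where
  form : carrier → carrier → K
  form_lin₁ : ∀ y, IsLinearMap K fun x => form x y
  form_lin₂ : ∀ x, IsLinearMap K (form x)
  findim : ∀ i : ℤ, FiniteDimensional K (toDGLA.cohomology i)
  form_degree : ∀ i j : ℤ, i + j ≠ n → ∀ x ∈ grading i, ∀ y ∈ grading j, form x y = 0
  form_symm : ∀ i j : ℤ, ∀ x ∈ grading i, ∀ y ∈ grading j,
      form x y = (-1 : K) ^ (i * j) * form y x
  form_d : ∀ i : ℤ, ∀ x ∈ grading i, ∀ y,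
      form (d x) y = (-1 : K) ^ (i + 1) * form x (d y)
  form_cyclic : ∀ x y z, form (br x y) z = form x (br y z)
  nondeg : ∀ i : ℤ, ∀ x ∈ toDGLA.cocycles i,
      (∀ y ∈ toDGLA.cocycles (n - i), form x y = 0) → x ∈ toDGLA.coboundaries i

/-- A splitting `L = H ⊕ d(K) ⊕ K` of the complex `(L, d)` into graded subspaces:
`d` vanishes on `H`, is injective on `K = Kc`, and in every degree `i` one has the
internal direct sum `L^i = H^i ⊕ d(K^{i-1}) ⊕ K^i`. -/
structure GradedSplitting (A : DGLA K) where
  H : ℤ → Submodule K A.carrier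
  Kc : ℤ → Submodule K A.carrier
  H_le : ∀ i, H i ≤ A.grading i
  Kc_le : ∀ i, Kc i ≤ A.grading i
  d_H : ∀ i, ∀ x ∈ H i, A.d x = 0
  d_Kc_inj : ∀ i, ∀ x ∈ Kc i, A.d x = 0 → x = 0
  decomp : ∀ i, H i ⊔ ((Kc (i - 1)).map A.dHom ⊔ Kc i) = A.grading i
  disj₁ : ∀ i, Disjoint (H i) ((Kc (i - 1)).map A.dHom ⊔ Kc i)
  disj₂ : ∀ i, Disjoint ((Kc (i - 1)).map A.dHom) (Kc i)

/-- The contraction data `(π, h)` determined by a splitting `L = H ⊕ d(K) ⊕ K`: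
`pr` is the projection onto `H`, and `h` the degree `-1` homotopy given by projecting
onto `d(K)`, applying `-d⁻¹` and including `K` into `L`.  The listed identities
determine `pr` and `h` uniquely. -/
structure ContractionData (A : DGLA K) (S : GradedSplitting A) where
  pr : A.carrier → A.carrier
  h : A.carrier → A.carrier
  pr_lin : IsLinearMap K pr
  h_lin : IsLinearMap K h
  pr_H : ∀ i : ℤ, ∀ x ∈ S.H i, pr x = x
  pr_dK : ∀ i : ℤ, ∀ x ∈ S.Kc i, pr (A.d x) = 0
  pr_K : ∀ i : ℤ, ∀ x ∈ S.Kc i, pr x = 0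
  h_H : ∀ i : ℤ, ∀ x ∈ S.H i, h x = 0
  h_dK : ∀ i : ℤ, ∀ x ∈ S.Kc i, h (A.d x) = -x
  h_K : ∀ i : ℤ, ∀ x ∈ S.Kc i, h x = 0

namespace DGLA

variable (A : DGLA K)

theorem dHom_apply (x : A.carrier) : A.dHom x = A.d x := rfl

theorem d_zero : A.d 0 = 0 := A.dHom.map_zero

theorem d_add (x y : A.carrier) : A.d (x + y) = A.d x + A.d y := A.dHom.map_add x y

theorem br_zero_left (y : A.carrier) : A.br 0 y = 0 := (A.br_lin₁ y).map_zero

theorem br_zero_right (x : A.carrier) : A.br x 0 = 0 := (A.br_lin₂ x).map_zero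

theorem br_add_right (x y z : A.carrier) : A.br x (y + z) = A.br x y + A.br x z :=
  (A.br_lin₂ x).map_add y z

/-- A degree `i + 1` element of the image of `d` is the differential of a degree `i` element. -/
theorem exists_mem_grading_d_eq {i : ℤ} {z : A.carrier} (hz : A.d z ∈ A.grading (i + 1)) :
    ∃ w ∈ A.grading i, A.d w = A.d z := by
  classical
  let _ := A.internal.chooseDecomposition
  suffices h : ∀ z : A.carrier, ∃ w ∈ A.grading i,
      A.d w = (DirectSum.decompose A.grading (A.d z) (i + 1) : A.carrier) by
    obtain ⟨w, hw, h⟩ := h z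
    exact ⟨w, hw, by rw [h, DirectSum.decompose_of_mem_same _ hz]⟩
  intro z
  have hz : z ∈ iSup A.grading := A.internal.submodule_iSup_eq_top ▸ Submodule.mem_top
  induction hz using Submodule.iSup_induction' with
  | mem j x hx =>
    by_cases hji : j = i
    · subst hji
      exact ⟨x, hx, by rw [DirectSum.decompose_of_mem_same _ (A.d_mem _ x hx)]⟩
    · exact ⟨0, zero_mem _, by
        rw [DirectSum.decompose_of_mem_ne _ (A.d_mem _ x hx) (by omega), d_zero]⟩
  | zero => exact ⟨0, zero_mem _, by simp [d_zero]⟩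
  | add x y _ _ ihx ihy =>
    obtain ⟨w, hw, h⟩ := ihx
    obtain ⟨w', hw', h'⟩ := ihy
    exact ⟨w + w', add_mem hw hw', by simp [d_add, h, h']⟩

end DGLA

namespace GradedSplitting

variable {A : DGLA K} (S : GradedSplitting A)

theorem exists_eq_add {i : ℤ} {x : A.carrier} (hx : x ∈ A.grading i) :
    ∃ h ∈ S.H i, ∃ k ∈ S.Kc (i - 1), ∃ l ∈ S.Kc i, x = h + (A.d k + l) := by
  rw [← S.decomp i] at hx
  obtain ⟨h, hh, y, hy, rfl⟩ := Submodule.mem_sup.1 hx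
  obtain ⟨_, ⟨k, hk, rfl⟩, l, hl, rfl⟩ := Submodule.mem_sup.1 hy
  exact ⟨h, hh, k, hk, l, hl, rfl⟩

theorem exists_eq_add_of_mem_cocycles {i : ℤ} {x : A.carrier} (hx : x ∈ A.cocycles i) :
    ∃ h ∈ S.H i, ∃ k ∈ S.Kc (i - 1), x = h + A.d k := by
  obtain ⟨h, hh, k, hk, l, hl, rfl⟩ := S.exists_eq_add hx.1
  have hd : A.d (h + (A.d k + l)) = 0 := hx.2
  rw [A.d_add, A.d_add, S.d_H i h hh, A.d_sq, zero_add, zero_add] at hd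
  rw [S.d_Kc_inj i l hl hd]
  exact ⟨h, hh, k, hk, by simp⟩

theorem mem_cocycles {i : ℤ} {x : A.carrier} (hx : x ∈ S.H i) : x ∈ A.cocycles i :=
  ⟨S.H_le i hx, S.d_H i x hx⟩

theorem eq_zero_of_eq_d {i : ℤ} {x z : A.carrier} (hx : x ∈ S.H i) (hz : A.d z = x) : x = 0 := by
  obtain ⟨w, hw, h⟩ := A.exists_mem_grading_d_eq (i := i - 1) (z := z)
    (by rw [hz, sub_add_cancel]; exact S.H_le i hx)
  obtain ⟨h', hh', k, hk, l, hl, rfl⟩ := S.exists_eq_add hw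
  rw [A.d_add, A.d_add, S.d_H _ _ hh', A.d_sq, zero_add, zero_add, hz] at h
  refine Submodule.disjoint_def.1 (S.disj₁ i) x hx (Submodule.mem_sup_left ⟨l, hl, h⟩)

end GradedSplitting

namespace QCyclicDGLA

variable {n : ℤ} (A : QCyclicDGLA K n)

/-- The form bundled as a bilinear map. -/
def formHom : A.carrier →ₗ[K] A.carrier →ₗ[K] K :=
  LinearMap.mk₂ K A.form (fun x y z => (A.form_lin₁ z).map_add x y)
    (fun c x y => (A.form_lin₁ y).map_smul c x) (fun x y z => (A.form_lin₂ x).map_add y z)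
    (fun c x y => (A.form_lin₂ x).map_smul c y)

theorem formHom_apply (x y : A.carrier) : A.formHom x y = A.form x y := rfl

theorem form_add_right (x y z : A.carrier) : A.form x (y + z) = A.form x y + A.form x z :=
  (A.form_lin₂ x).map_add y z

theorem form_add_left (x y z : A.carrier) : A.form (x + y) z = A.form x z + A.form y z :=
  (A.form_lin₁ z).map_add x y

theorem form_eq_zero_comm {i j : ℤ} {x y : A.carrier} (hx : x ∈ A.grading i)
    (hy : y ∈ A.grading j) (h : A.form x y = 0) : A.form y x = 0 := by
  rw [A.form_symm j i y hy x hx, h, mul_zero]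

theorem form_d_left_eq_zero {i : ℤ} {x y : A.carrier} (hx : x ∈ A.grading i) (hy : A.d y = 0) :
    A.form (A.d x) y = 0 := by
  rw [A.form_d i x hx, hy, (A.form_lin₂ x).map_zero, mul_zero]

theorem form_d_right_eq_zero {i : ℤ} {x y : A.carrier} (hx : x ∈ A.grading i) (hdx : A.d x = 0) :
    A.form x (A.d y) = 0 := by
  have h := A.form_d i x hx y
  rw [hdx, (A.form_lin₁ y).map_zero] at h
  exact (mul_eq_zero.1 h.symm).resolve_left (zpow_ne_zero _ (by simp))

variable (S : GradedSplitting A.toDGLA)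

/-- The form is non-degenerate on `H`. -/
theorem eq_zero_of_form_left_eq_zero {i : ℤ} {x : A.carrier} (hx : x ∈ S.H i)
    (h : ∀ y ∈ S.H (n - i), A.form x y = 0) : x = 0 := by
  have hc : x ∈ A.coboundaries i := A.nondeg i x (S.mem_cocycles hx) fun y hy => by
    obtain ⟨y, hyH, k, -, rfl⟩ := S.exists_eq_add_of_mem_cocycles hy
    rw [A.form_add_right, h y hyH, A.form_d_right_eq_zero (S.H_le i hx) (S.d_H i x hx), add_zero]
  obtain ⟨z, hz⟩ := hc.2
  exact S.eq_zero_of_eq_d hx hz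

theorem eq_zero_of_form_right_eq_zero {i : ℤ} {x : A.carrier} (hx : x ∈ S.H i)
    (h : ∀ y ∈ S.H (n - i), A.form y x = 0) : x = 0 :=
  A.eq_zero_of_form_left_eq_zero S hx fun y hy =>
    A.form_eq_zero_comm (S.H_le _ hy) (S.H_le _ hx) (h y hy)

theorem finiteDimensional_H (i : ℤ) : FiniteDimensional K (S.H i) := by
  have := A.findim i
  let f : S.H i →ₗ[K] A.cohomology i :=
    (Submodule.mkQ _).comp (Submodule.inclusion fun _ hx => S.mem_cocycles hx)
  refine FiniteDimensional.of_injective f ((injective_iff_map_eq_zero f).2 fun x hx => ?_)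
  obtain ⟨z, hz⟩ := ((Submodule.Quotient.mk_eq_zero _).1 hx).2
  exact Subtype.ext (S.eq_zero_of_eq_d x.2 hz)

theorem isPerfPair_H (i : ℤ) :
    (A.formHom.domRestrict₁₂ (S.H (n - i)) (S.H i)).IsPerfPair := by
  have := A.finiteDimensional_H S (n - i)
  refine .of_injective ((injective_iff_map_eq_zero _).2 fun x hx => ?_)
    ((injective_iff_map_eq_zero _).2 fun x hx => ?_)
  · refine Subtype.ext (A.eq_zero_of_form_left_eq_zero S x.2 fun y hy => ?_)
    rw [sub_sub_cancel] at hy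
    exact DFunLike.congr_fun hx ⟨y, hy⟩
  · exact Subtype.ext (A.eq_zero_of_form_right_eq_zero S x.2 fun y hy =>
      DFunLike.congr_fun hx ⟨y, hy⟩)

/-- Every functional on `H` given by the form is represented by an element of `H`. -/
theorem exists_mem_H_form_eq (i : ℤ) (x : A.carrier) :
    ∃ h ∈ S.H i, ∀ y ∈ S.H (n - i), A.form y h = A.form y x := by
  obtain ⟨h, hh⟩ := (A.isPerfPair_H S i).bijective_right.surjective
    ((A.formHom.flip x).domRestrict (S.H (n - i)))
  exact ⟨h, h.2, fun y hy => DFunLike.congr_fun hh ⟨y, hy⟩⟩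

/-- The part of `H ⊕ K` orthogonal to `H`, in positive degrees. -/
noncomputable def orthKc (i : ℤ) : Submodule K A.carrier :=
  if 0 < i then (S.H i ⊔ S.Kc i) ⊓ (S.H (n - i)).orthogonalBilin A.formHom else ⊥

variable {S}

theorem mem_orthKc {i : ℤ} (hi : 0 < i) {x : A.carrier} :
    x ∈ A.orthKc S i ↔ x ∈ S.H i ⊔ S.Kc i ∧ ∀ y ∈ S.H (n - i), A.form y x = 0 := by
  rw [orthKc, if_pos hi]
  rfl

theorem orthKc_of_nonpos {i : ℤ} (hi : i ≤ 0) : A.orthKc S i = ⊥ := if_neg hi.not_gt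

variable (S)

theorem orthKc_le (i : ℤ) : A.orthKc S i ≤ S.H i ⊔ S.Kc i := by
  rw [orthKc]
  split_ifs
  exacts [inf_le_left, bot_le]

theorem orthKc_le_grading (i : ℤ) : A.orthKc S i ≤ A.grading i :=
  (A.orthKc_le S i).trans (sup_le (S.H_le i) (S.Kc_le i))

theorem exists_sub_mem_orthKc {i : ℤ} (hi : 0 < i) {k : A.carrier} (hk : k ∈ S.Kc i) :
    ∃ h ∈ S.H i, k - h ∈ A.orthKc S i := by
  obtain ⟨h, hh, H⟩ := A.exists_mem_H_form_eq S i k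
  refine ⟨h, hh, (A.mem_orthKc hi).2 ⟨sub_mem (Submodule.mem_sup_right hk)
    (Submodule.mem_sup_left hh), fun y hy => ?_⟩⟩
  rw [(A.form_lin₂ y).map_sub, H y hy, sub_self]

theorem H_sup_orthKc {i : ℤ} (hi : 0 < i) : S.H i ⊔ A.orthKc S i = S.H i ⊔ S.Kc i := by
  refine le_antisymm (sup_le le_sup_left (A.orthKc_le S i)) (sup_le le_sup_left fun k hk => ?_)
  obtain ⟨h, hh, H⟩ := A.exists_sub_mem_orthKc S hi hk
  exact Submodule.mem_sup.2 ⟨h, hh, _, H, by abel⟩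

theorem map_d_orthKc {i : ℤ} (hi : 0 < i) :
    (S.Kc i).map A.dHom ≤ (A.orthKc S i).map A.dHom := by
  rintro _ ⟨k, hk, rfl⟩
  obtain ⟨h, hh, H⟩ := A.exists_sub_mem_orthKc S hi hk
  refine ⟨_, H, ?_⟩
  rw [map_sub, A.dHom_apply h, S.d_H i h hh, sub_zero]

theorem eq_zero_of_mem_orthKc {i : ℤ} {x : A.carrier} (hx : x ∈ A.orthKc S i)
    (hd : A.d x = 0) : x = 0 := by
  rcases le_or_gt i 0 with hi | hi
  · simpa [A.orthKc_of_nonpos hi] using hx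
  · obtain ⟨hx, ho⟩ := (A.mem_orthKc hi).1 hx
    obtain ⟨h, hh, k, hk, rfl⟩ := Submodule.mem_sup.1 hx
    rw [A.d_add, S.d_H i h hh, zero_add] at hd
    rw [S.d_Kc_inj i k hk hd, add_zero] at ho ⊢
    exact A.eq_zero_of_form_right_eq_zero S hh ho

theorem form_orthKc {i j : ℤ} {x y : A.carrier} (hx : x ∈ S.H i) (hy : y ∈ A.orthKc S j) :
    A.form x y = 0 := by
  by_cases hij : i + j = n
  · rcases le_or_gt j 0 with hj | hj
    · rw [A.orthKc_of_nonpos hj, Submodule.mem_bot] at hy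
      rw [hy, (A.form_lin₂ x).map_zero]
    · exact ((A.mem_orthKc hj).1 hy).2 x (eq_sub_of_add_eq hij ▸ hx)
  · exact A.form_degree i j hij x (S.H_le i hx) y (A.orthKc_le_grading S j hy)

/-- The graded subspace `H ⊕ d(K') ⊕ K'` of `L`, where `K'` is `QCyclicDGLA.orthKc`. -/
noncomputable def orthSub (i : ℤ) : Submodule K A.carrier :=
  S.H i ⊔ ((A.orthKc S (i - 1)).map A.dHom ⊔ A.orthKc S i)

variable {S}

theorem exists_eq_add_of_mem_orthSub {i : ℤ} {x : A.carrier} (hx : x ∈ A.orthSub S i) :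
    ∃ h ∈ S.H i, ∃ k ∈ A.orthKc S (i - 1), ∃ l ∈ A.orthKc S i, x = h + (A.d k + l) := by
  obtain ⟨h, hh, y, hy, rfl⟩ := Submodule.mem_sup.1 hx
  obtain ⟨_, ⟨k, hk, rfl⟩, l, hl, rfl⟩ := Submodule.mem_sup.1 hy
  exact ⟨h, hh, k, hk, l, hl, rfl⟩

theorem exists_eq_add_of_mem_orthSub_of_d_eq_zero {i : ℤ} {x : A.carrier}
    (hx : x ∈ A.orthSub S i) (hd : A.d x = 0) :
    ∃ h ∈ S.H i, ∃ k ∈ A.orthKc S (i - 1), x = h + A.d k := by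
  obtain ⟨h, hh, k, hk, l, hl, rfl⟩ := A.exists_eq_add_of_mem_orthSub hx
  rw [A.d_add, A.d_add, S.d_H i h hh, A.d_sq, zero_add, zero_add] at hd
  rw [A.eq_zero_of_mem_orthKc S hl hd]
  exact ⟨h, hh, k, hk, by simp⟩

variable (S)

theorem orthKc_le_orthSub (i : ℤ) : A.orthKc S i ≤ A.orthSub S i :=
  le_sup_right.trans le_sup_right

theorem orthSub_le_grading (i : ℤ) : A.orthSub S i ≤ A.grading i := by
  refine sup_le (S.H_le i) (sup_le ?_ (A.orthKc_le_grading S i))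
  rintro _ ⟨k, hk, rfl⟩
  simpa [A.dHom_apply] using A.d_mem _ k (A.orthKc_le_grading S _ hk)

theorem d_mem_orthSub {i : ℤ} {x : A.carrier} (hx : x ∈ A.orthSub S i) :
    A.d x ∈ A.orthSub S (i + 1) := by
  obtain ⟨h, hh, k, hk, l, hl, rfl⟩ := A.exists_eq_add_of_mem_orthSub hx
  rw [A.d_add, A.d_add, S.d_H i h hh, A.d_sq, zero_add, zero_add]
  refine Submodule.mem_sup_right (Submodule.mem_sup_left ⟨l, ?_, rfl⟩)
  rwa [add_sub_cancel_right]

theorem orthSub_of_nonpos {i : ℤ} (hi : i ≤ 0) : A.orthSub S i = S.H i := by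
  simp [orthSub, A.orthKc_of_nonpos hi, A.orthKc_of_nonpos (show i - 1 ≤ 0 by omega)]

theorem orthSub_one : A.orthSub S 1 = S.H 1 ⊔ S.Kc 1 := by
  rw [orthSub, A.orthKc_of_nonpos (by norm_num), Submodule.map_bot, bot_sup_eq,
    A.H_sup_orthKc S one_pos]

theorem orthSub_of_two_le {i : ℤ} (hi : 2 ≤ i) : A.orthSub S i = A.grading i := by
  refine le_antisymm (A.orthSub_le_grading S i) ?_
  rw [← S.decomp i, sup_left_comm]
  refine sup_le ((A.map_d_orthKc S (by omega)).trans (le_sup_left.trans le_sup_right)) ?_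
  rw [← A.H_sup_orthKc S (by omega)]
  exact sup_le_sup_left le_sup_right _

variable {S}

theorem br_mem_H
    (h1 : ∀ i : ℤ, i < 0 → S.H i = ⊥)
    (h2 : ∀ x ∈ S.H 0, ∀ y ∈ S.H 0, A.br x y ∈ S.H 0)
    (h3H : ∀ i : ℤ, 0 < i → ∀ g ∈ S.H 0, ∀ x ∈ S.H i, A.br g x ∈ S.H i)
    (i : ℤ) {g x : A.carrier} (hg : g ∈ S.H 0) (hx : x ∈ S.H i) :
    A.br g x ∈ S.H i := by
  rcases lt_trichotomy i 0 with hi | rfl | hi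
  · rw [h1 i hi, Submodule.mem_bot] at hx
    rw [hx, A.br_zero_right]
    exact zero_mem _
  · exact h2 g hg x hx
  · exact h3H i hi g hg x hx

theorem br_mem_H_sup_Kc
    (h3H : ∀ i : ℤ, 0 < i → ∀ g ∈ S.H 0, ∀ x ∈ S.H i, A.br g x ∈ S.H i)
    (h3K : ∀ i : ℤ, 0 < i → ∀ g ∈ S.H 0, ∀ x ∈ S.Kc i, A.br g x ∈ S.Kc i)
    {i : ℤ} (hi : 0 < i) {g x : A.carrier} (hg : g ∈ S.H 0)
    (hx : x ∈ S.H i ⊔ S.Kc i) : A.br g x ∈ S.H i ⊔ S.Kc i := by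
  obtain ⟨h, hh, k, hk, rfl⟩ := Submodule.mem_sup.1 hx
  rw [A.br_add_right]
  exact Submodule.add_mem_sup (h3H i hi g hg h hh) (h3K i hi g hg k hk)

theorem br_mem_orthKc
    (h1 : ∀ i : ℤ, i < 0 → S.H i = ⊥)
    (h2 : ∀ x ∈ S.H 0, ∀ y ∈ S.H 0, A.br x y ∈ S.H 0)
    (h3H : ∀ i : ℤ, 0 < i → ∀ g ∈ S.H 0, ∀ x ∈ S.H i, A.br g x ∈ S.H i)
    (h3K : ∀ i : ℤ, 0 < i → ∀ g ∈ S.H 0, ∀ x ∈ S.Kc i, A.br g x ∈ S.Kc i)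
    (i : ℤ) {g x : A.carrier} (hg : g ∈ S.H 0) (hx : x ∈ A.orthKc S i) :
    A.br g x ∈ A.orthKc S i := by
  rcases le_or_gt i 0 with hi | hi
  · rw [A.orthKc_of_nonpos hi, Submodule.mem_bot] at hx
    rw [hx, A.br_zero_right]
    exact zero_mem _
  · rw [A.mem_orthKc hi] at hx ⊢
    refine ⟨A.br_mem_H_sup_Kc h3H h3K hi hg hx.1, fun y hy => ?_⟩
    rw [← A.form_cyclic]
    refine hx.2 _ ?_
    rw [A.skew _ _ y (S.H_le _ hy) g (S.H_le _ hg)]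
    exact neg_mem (Submodule.smul_mem _ _ (A.br_mem_H h1 h2 h3H _ hg hy))

theorem br_mem_orthSub
    (h1 : ∀ i : ℤ, i < 0 → S.H i = ⊥)
    (h2 : ∀ x ∈ S.H 0, ∀ y ∈ S.H 0, A.br x y ∈ S.H 0)
    (h3H : ∀ i : ℤ, 0 < i → ∀ g ∈ S.H 0, ∀ x ∈ S.H i, A.br g x ∈ S.H i)
    (h3K : ∀ i : ℤ, 0 < i → ∀ g ∈ S.H 0, ∀ x ∈ S.Kc i, A.br g x ∈ S.Kc i)
    {i j : ℤ} {x y : A.carrier} (hx : x ∈ A.orthSub S i)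
    (hy : y ∈ A.orthSub S j) : A.br x y ∈ A.orthSub S (i + j) := by
  have hneg : ∀ {i : ℤ} {x : A.carrier}, i < 0 → x ∈ A.orthSub S i → x = 0 := by
    intro i x hi hx
    rwa [A.orthSub_of_nonpos S hi.le, h1 i hi, Submodule.mem_bot] at hx
  have hact : ∀ {j : ℤ} {g y : A.carrier}, g ∈ A.orthSub S 0 → y ∈ A.orthSub S j →
      A.br g y ∈ A.orthSub S j := by
    intro j g y hg hy
    have hg' := hg
    rw [A.orthSub_of_nonpos S le_rfl] at hg
    rcases le_or_gt j 0 with hj | hj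
    · rw [A.orthSub_of_nonpos S hj] at hy ⊢
      exact A.br_mem_H h1 h2 h3H j hg hy
    rcases (show 1 ≤ j from hj).eq_or_lt with rfl | hj'
    · rw [A.orthSub_one S] at hy ⊢
      exact A.br_mem_H_sup_Kc h3H h3K one_pos hg hy
    · rw [A.orthSub_of_two_le S hj'] at hy ⊢
      simpa using A.br_mem 0 j g (A.orthSub_le_grading S 0 hg') y hy
  have hx' := A.orthSub_le_grading S i hx
  have hy' := A.orthSub_le_grading S j hy
  rcases lt_trichotomy i 0 with hi | rfl | hi
  · rw [hneg hi hx, A.br_zero_left]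
    exact zero_mem _
  · rw [zero_add]
    exact hact hx hy
  rcases lt_trichotomy j 0 with hj | rfl | hj
  · rw [hneg hj hy, A.br_zero_right]
    exact zero_mem _
  · rw [A.skew _ _ x hx' y hy', add_zero]
    exact neg_mem (Submodule.smul_mem _ _ (hact hy hx))
  · rw [A.orthSub_of_two_le S (by omega)]
    exact A.br_mem i j x hx' y hy'

end QCyclicDGLA

/-- **Lemma (reduction to a semiorthogonal splitting).**
Given a quasi-cyclic DGLA of degree `n` with a splitting `L = H ⊕ d(K) ⊕ K` as in the
main theorem, there is a DG-Lie subalgebra `L' ⊆ L` (a graded subspace `L'` closed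
under `d` and the bracket) such that the inclusion `L' → L` is a quasi-isomorphism,
the restriction of the form makes `L'` quasi-cyclic of degree `n` (the degree,
symmetry, `d`-compatibility and cyclicity conditions restrict automatically, so this
amounts to: finite dimensional cohomology and non-degeneracy of the induced pairing on
the cohomology of `L'`), and `L'` admits a splitting `L' = H ⊕ d(K') ⊕ K'` with
`H^i = 0` for `i < 0`, `H^0` bracket-closed, `H^i` and `K'^i` being `H^0`-submodules
for all `i ∈ ℤ`, and `H ⊥ K'`. -/
theorem exists_semiorthogonal_splitting
    {K : Type} [Field K] [CharZero K] {n : ℤ}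
    (A : QCyclicDGLA K n) (S : GradedSplitting A.toDGLA)
    (h1 : ∀ i : ℤ, i < 0 → S.H i = ⊥)
    (h2 : ∀ x ∈ S.H 0, ∀ y ∈ S.H 0, A.br x y ∈ S.H 0)
    (h3H : ∀ i : ℤ, 0 < i → ∀ g ∈ S.H 0, ∀ x ∈ S.H i, A.br g x ∈ S.H i)
    (h3K : ∀ i : ℤ, 0 < i → ∀ g ∈ S.H 0, ∀ x ∈ S.Kc i, A.br g x ∈ S.Kc i) :
    ∃ L' : ℤ → Submodule K A.carrier,
      -- `L'` is a graded DG-Lie subalgebra of `L`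
      (∀ i, L' i ≤ A.grading i) ∧
      (∀ i, ∀ x ∈ L' i, A.d x ∈ L' (i + 1)) ∧
      (∀ i j, ∀ x ∈ L' i, ∀ y ∈ L' j, A.br x y ∈ L' (i + j)) ∧
      (∀ i, S.H i ≤ L' i) ∧
      -- the inclusion `L' → L` is a quasi-isomorphism
      (∀ i, ∀ x ∈ L' i, A.d x = 0 → x ∈ A.toDGLA.coboundaries i →
        x ∈ (L' (i - 1)).map A.dHom) ∧
      (∀ i, ∀ y ∈ A.toDGLA.cocycles i, ∃ x ∈ L' i, A.d x = 0 ∧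
        x - y ∈ A.toDGLA.coboundaries i) ∧
      -- the restriction of the form makes `L'` quasi-cyclic of degree `n`:
      -- non-degeneracy of the induced pairing on the cohomology of `L'` …
      (∀ i, ∀ x ∈ L' i, A.d x = 0 →
        (∀ y ∈ L' (n - i), A.d y = 0 → A.form x y = 0) →
        x ∈ (L' (i - 1)).map A.dHom) ∧
      -- … and finite dimensionality of the cohomology of `L'`
      (∀ i, ∃ W : Submodule K A.carrier, FiniteDimensional K W ∧ W ≤ L' i ∧
        (∀ w ∈ W, A.d w = 0) ∧
        ∀ x ∈ L' i, A.d x = 0 → x ∈ W ⊔ (L' (i - 1)).map A.dHom) ∧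
      -- the splitting `L' = H ⊕ d(K') ⊕ K'`
      ∃ K' : ℤ → Submodule K A.carrier,
        (∀ i, K' i ≤ L' i) ∧
        (∀ i, ∀ x ∈ K' i, A.d x = 0 → x = 0) ∧
        (∀ i, S.H i ⊔ ((K' (i - 1)).map A.dHom ⊔ K' i) = L' i) ∧
        (∀ i, Disjoint (S.H i) ((K' (i - 1)).map A.dHom ⊔ K' i)) ∧
        (∀ i, Disjoint ((K' (i - 1)).map A.dHom) (K' i)) ∧
        -- (3) `H^i` and `K'^i` are `H^0`-submodules for all `i ∈ ℤ`
        (∀ i : ℤ, ∀ g ∈ S.H 0,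
          (∀ x ∈ S.H i, A.br g x ∈ S.H i) ∧ (∀ x ∈ K' i, A.br g x ∈ K' i)) ∧
        -- (4) `H ⊥ K'`
        (∀ i j : ℤ, ∀ x ∈ S.H i, ∀ y ∈ K' j, A.form x y = 0) := by
  have hle : ∀ i, ∀ k ∈ A.orthKc S (i - 1), A.d k ∈ (A.orthSub S (i - 1)).map A.dHom :=
    fun i k hk => ⟨k, A.orthKc_le_orthSub S _ hk, rfl⟩
  refine ⟨A.orthSub S, A.orthSub_le_grading S, fun i x hx => A.d_mem_orthSub S hx,
    fun i j x hx y hy => A.br_mem_orthSub h1 h2 h3H h3K hx hy, fun i => le_sup_left,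
    fun i x hx hd hc => ?_, fun i y hy => ?_, fun i x hx hd hf => ?_,
    fun i => ⟨S.H i, A.finiteDimensional_H S i, le_sup_left, S.d_H i, fun x hx hd => ?_⟩,
    A.orthKc S, A.orthKc_le_orthSub S, fun i x hx => A.eq_zero_of_mem_orthKc S hx,
    fun i => rfl, fun i => ?_, fun i => ?_,
    fun i g hg => ⟨fun x hx => A.br_mem_H h1 h2 h3H i hg hx,
      fun x hx => A.br_mem_orthKc h1 h2 h3H h3K i hg hx⟩,
    fun i j x hx y hy => A.form_orthKc S hx hy⟩
  · obtain ⟨h, hh, k, hk, rfl⟩ := A.exists_eq_add_of_mem_orthSub_of_d_eq_zero hx hd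
    obtain ⟨z, hz⟩ := hc.2
    rw [S.eq_zero_of_eq_d (z := z - k) hh
      (by rw [← A.dHom_apply, map_sub, hz, A.dHom_apply, add_sub_cancel_right]), zero_add]
    exact hle i k hk
  · obtain ⟨h, hh, k, hk, rfl⟩ := S.exists_eq_add_of_mem_cocycles hy
    refine ⟨h, Submodule.mem_sup_left hh, S.d_H i h hh,
      sub_mem (S.H_le i hh) hy.1, -k, ?_⟩
    rw [map_neg, A.dHom_apply]
    abel
  · obtain ⟨h, hh, k, hk, rfl⟩ := A.exists_eq_add_of_mem_orthSub_of_d_eq_zero hx hd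
    rw [A.eq_zero_of_form_left_eq_zero S hh fun y hy => ?_, zero_add]
    · exact hle i k hk
    · have hdy := S.d_H _ y hy
      have := hf y (Submodule.mem_sup_left hy) hdy
      rwa [A.form_add_left, A.form_d_left_eq_zero (A.orthKc_le_grading S _ hk) hdy,
        add_zero] at this
  · obtain ⟨h, hh, k, hk, rfl⟩ := A.exists_eq_add_of_mem_orthSub_of_d_eq_zero hx hd
    exact Submodule.add_mem_sup hh (hle i k hk)
  · refine Submodule.disjoint_def.2 fun x hx hx' => ?_
    obtain ⟨_, ⟨k, hk, rfl⟩, l, hl, rfl⟩ := Submodule.mem_sup.1 hx'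
    have hd := S.d_H i _ hx
    rw [A.d_add, A.dHom_apply, A.d_sq, zero_add] at hd
    rw [A.eq_zero_of_mem_orthKc S hl hd, add_zero] at hx ⊢
    exact S.eq_zero_of_eq_d hx rfl
  · refine Submodule.disjoint_def.2 fun x hx hx' => ?_
    obtain ⟨k, hk, rfl⟩ := hx
    exact A.eq_zero_of_mem_orthKc S hx' (A.d_sq k)
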